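/- Let θ ↦ π_θ be a parametrized policy family whose score function is bounded with constant Π_*, and let ε > 0. Then for all θ, θ_old ∈ ℝ^d, the largest absolute coordinate of g_PPO(θ, θ_old) − g_PPO^clip(θ, θ_old) is at most C · MeanTV(π_{θ_old}, π_θ), where C := 4 Π_* R_* (1 + 1/ε) · T/(1−γ). -/

import Mathlib

/-- Value with `n` steps remaining. -/
noncomputable def valAux {S A : Type*} [Fintype S] [Fintype A]
    (γ : ℝ) (r : S → A → ℝ) (p : S → A → S → ℝ) (π : S → A → ℝ) : ℕ → S → ℝ
  | 0 => fun _ => 0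
  | n + 1 => fun s => ∑ a, π s a * (r s a + γ * ∑ s', p s a s' * valAux γ r p π n s')

/-- Finite-horizon value function `V_t^π` with horizon `T`. -/
noncomputable def Vval {S A : Type*} [Fintype S] [Fintype A]
    (γ : ℝ) (r : S → A → ℝ) (p : S → A → S → ℝ) (π : S → A → ℝ)
    (T t : ℕ) (s : S) : ℝ :=
  valAux γ r p π (T - t) s

/-- Finite-horizon state-action value `Q_t^π(s,a)`. -/
noncomputable def Qval {S A : Type*} [Fintype S] [Fintype A]
    (γ : ℝ) (r : S → A → ℝ) (p : S → A → S → ℝ) (π : S → A → ℝ)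
    (T t : ℕ) (s : S) (a : A) : ℝ :=
  r s a + γ * ∑ s', p s a s' * Vval γ r p π T (t + 1) s'

/-- Advantage `𝔸_t^π(s,a) = Q_t^π(s,a) - V_t^π(s)`. -/
noncomputable def Adv {S A : Type*} [Fintype S] [Fintype A]
    (γ : ℝ) (r : S → A → ℝ) (p : S → A → S → ℝ) (π : S → A → ℝ)
    (T t : ℕ) (s : S) (a : A) : ℝ :=
  Qval γ r p π T t s a - Vval γ r p π T t s

/-- State marginals `d_t^π`. -/
noncomputable def stateMarginal {S A : Type*} [Fintype S] [Fintype A]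
    (p : S → A → S → ℝ) (μ : S → ℝ) (π : S → A → ℝ) : ℕ → S → ℝ
  | 0 => μ
  | t + 1 => fun s => ∑ s', stateMarginal p μ π t s' * ∑ a, π s' a * p s' a s

/-- Unclipped PPO surrogate gradient. -/
noncomputable def gPPO {S A : Type*} [Fintype S] [Fintype A] {d : ℕ}
    (γ : ℝ) (r : S → A → ℝ) (p : S → A → S → ℝ) (μ : S → ℝ) (T : ℕ)
    (π : EuclideanSpace ℝ (Fin d) → S → A → ℝ)
    (θ θold : EuclideanSpace ℝ (Fin d)) : EuclideanSpace ℝ (Fin d) :=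
  ∑ t ∈ Finset.range T, ∑ s, ∑ a,
    (γ ^ t * stateMarginal p μ (π θold) t s * Adv γ r p (π θold) T t s a) •
      gradient (fun θ' => π θ' s a) θ

/-- Clipped PPO surrogate gradient with clipping parameter `ε`. -/
noncomputable def gPPOclip {S A : Type*} [Fintype S] [Fintype A] {d : ℕ}
    (γ : ℝ) (r : S → A → ℝ) (p : S → A → S → ℝ) (μ : S → ℝ) (T : ℕ) (ε : ℝ)
    (π : EuclideanSpace ℝ (Fin d) → S → A → ℝ)
    (θ θold : EuclideanSpace ℝ (Fin d)) : EuclideanSpace ℝ (Fin d) :=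
  ∑ t ∈ Finset.range T, ∑ s, ∑ a,
    (γ ^ t * stateMarginal p μ (π θold) t s *
        (if |π θ s a / π θold s a - 1| ≤ ε then (1 : ℝ) else 0) *
        Adv γ r p (π θold) T t s a) •
      gradient (fun θ' => π θ' s a) θ

lemma abs_sum_mul_le_of_sum_eq_one {ι : Type*} [Fintype ι] {w f : ι → ℝ} {B : ℝ}
    (hw0 : ∀ i, 0 ≤ w i) (hw1 : ∑ i, w i = 1) (hf : ∀ i, |f i| ≤ B) :
    |∑ i, w i * f i| ≤ B := by
  calc |∑ i, w i * f i| ≤ ∑ i, |w i * f i| := Finset.abs_sum_le_sum_abs _ _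
    _ ≤ ∑ i, w i * B := Finset.sum_le_sum fun i _ => by
        rw [abs_mul, abs_of_nonneg (hw0 i)]
        exact mul_le_mul_of_nonneg_left (hf i) (hw0 i)
    _ = B := by rw [← Finset.sum_mul, hw1, one_mul]

lemma abs_reward_add_discounted_le {ι : Type*} [Fintype ι] {γ R x : ℝ} (hγ0 : 0 ≤ γ)
    (hγ1 : γ < 1) (hx : |x| ≤ R) {w f : ι → ℝ} (hw0 : ∀ i, 0 ≤ w i) (hw1 : ∑ i, w i = 1)
    (hf : ∀ i, |f i| ≤ R / (1 - γ)) :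
    |x + γ * ∑ i, w i * f i| ≤ R / (1 - γ) := by
  have hsum := abs_sum_mul_le_of_sum_eq_one hw0 hw1 hf
  have hne : 1 - γ ≠ 0 := by linarith
  calc |x + γ * ∑ i, w i * f i| ≤ |x| + |γ * ∑ i, w i * f i| := abs_add_le _ _
    _ ≤ R + γ * (R / (1 - γ)) := by
        rw [abs_mul, abs_of_nonneg hγ0]
        gcongr
    _ = R / (1 - γ) := by field_simp; ring

section ValueBounds

variable {S A : Type*} [Fintype S] [Fintype A] {γ R : ℝ} {r : S → A → ℝ}
  {p : S → A → S → ℝ} {π : S → A → ℝ}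

lemma abs_valAux_le (hγ0 : 0 ≤ γ) (hγ1 : γ < 1) (hR : 0 ≤ R) (hr : ∀ s a, |r s a| ≤ R)
    (hp0 : ∀ s a s', 0 ≤ p s a s') (hp1 : ∀ s a, ∑ s', p s a s' = 1)
    (hπ0 : ∀ s a, 0 ≤ π s a) (hπ1 : ∀ s, ∑ a, π s a = 1) (n : ℕ) (s : S) :
    |valAux γ r p π n s| ≤ R / (1 - γ) := by
  induction n generalizing s with
  | zero =>
    simp only [valAux, abs_zero]
    exact div_nonneg hR (by linarith)
  | succ n ih =>
    exact abs_sum_mul_le_of_sum_eq_one (hπ0 s) (hπ1 s) fun a =>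
      abs_reward_add_discounted_le hγ0 hγ1 (hr s a) (hp0 s a) (hp1 s a) ih

lemma abs_Adv_le (hγ0 : 0 ≤ γ) (hγ1 : γ < 1) (hR : 0 ≤ R) (hr : ∀ s a, |r s a| ≤ R)
    (hp0 : ∀ s a s', 0 ≤ p s a s') (hp1 : ∀ s a, ∑ s', p s a s' = 1)
    (hπ0 : ∀ s a, 0 ≤ π s a) (hπ1 : ∀ s, ∑ a, π s a = 1) (T t : ℕ) (s : S) (a : A) :
    |Adv γ r p π T t s a| ≤ 2 * (R / (1 - γ)) := by
  have hV := abs_valAux_le hγ0 hγ1 hR hr hp0 hp1 hπ0 hπ1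
  have hQ : |Qval γ r p π T t s a| ≤ R / (1 - γ) :=
    abs_reward_add_discounted_le hγ0 hγ1 (hr s a) (hp0 s a) (hp1 s a) (hV _)
  calc |Adv γ r p π T t s a| ≤ |Qval γ r p π T t s a| + |Vval γ r p π T t s| := abs_sub _ _
    _ ≤ R / (1 - γ) + R / (1 - γ) := add_le_add hQ (hV _ s)
    _ = 2 * (R / (1 - γ)) := by ring

lemma stateMarginal_nonneg {μ : S → ℝ} (hμ0 : ∀ s, 0 ≤ μ s)
    (hp0 : ∀ s a s', 0 ≤ p s a s') (hπ0 : ∀ s a, 0 ≤ π s a) (t : ℕ) (s : S) :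
    0 ≤ stateMarginal p μ π t s := by
  induction t generalizing s with
  | zero => exact hμ0 s
  | succ t ih =>
    exact Finset.sum_nonneg fun s' _ => mul_nonneg (ih s') <|
      Finset.sum_nonneg fun a _ => mul_nonneg (hπ0 s' a) (hp0 s' a s)

end ValueBounds

/-- The mass of `x` where the ratio `x / y` is clipped is controlled by the distance to `y`. -/
lemma one_sub_indicator_mul_le {ε x y : ℝ} (hε : 0 < ε) (hy : 0 < y) :
    (1 - if |x / y - 1| ≤ ε then (1 : ℝ) else 0) * x ≤ (1 + 1 / ε) * |y - x| := by
  split_ifs with h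
  · rw [sub_self, zero_mul]
    positivity
  · have hxy : x / y - 1 = (x - y) / y := by field_simp
    rw [not_le, hxy, abs_div, abs_of_pos hy, lt_div_iff₀ hy, abs_sub_comm] at h
    have hyle : y ≤ 1 / ε * |y - x| := by
      rw [one_div_mul_eq_div, le_div_iff₀ hε]
      linarith
    have hx := neg_abs_le (y - x)
    linarith

/-- **clipped vs. unclipped surrogate gradient bias.** Coordinatewise,
`|g_PPO(θ,θold) - g_PPO^clip(θ,θold)| ≤ C ⬝ MeanTV(π_θold, π_θ)` with
`C = 4 Π_* R_* (1 + 1/ε) T/(1-γ)`. -/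
theorem clipped_surrogate_bias {S A : Type*} [Fintype S] [Fintype A]
    [Nonempty S] [Nonempty A] {d : ℕ}
    (γ : ℝ) (hγ0 : 0 < γ) (hγ1 : γ < 1)
    (T : ℕ) (hT : 1 ≤ T)
    (Rs : ℝ) (r : S → A → ℝ) (hr : ∀ s a, |r s a| ≤ Rs)
    (p : S → A → S → ℝ) (hp0 : ∀ s a s', 0 ≤ p s a s') (hp1 : ∀ s a, ∑ s', p s a s' = 1)
    (μ : S → ℝ) (hμ0 : ∀ s, 0 ≤ μ s) (hμ1 : ∑ s, μ s = 1)
    (π : EuclideanSpace ℝ (Fin d) → S → A → ℝ)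
    (hπpos : ∀ θ s a, 0 < π θ s a)
    (hπ1 : ∀ θ s, ∑ a, π θ s a = 1)
    (hπdiff : ∀ s a, ContDiff ℝ 1 fun θ => π θ s a)
    (Pis : ℝ)
    (hscore : ∀ θ s a, ‖gradient (fun θ' => π θ' s a) θ‖ ≤ Pis * π θ s a)
    (ε : ℝ) (hε : 0 < ε)
    (θ θold : EuclideanSpace ℝ (Fin d)) :
    ∀ i : Fin d,
      |(gPPO γ r p μ T π θ θold - gPPOclip γ r p μ T ε π θ θold) i|
        ≤ (4 * Pis * Rs * (1 + 1 / ε) * (T : ℝ) / (1 - γ)) *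
            ((1 / (T : ℝ)) * ∑ t ∈ Finset.range T, ∑ s,
              stateMarginal p μ (π θold) t s *
                ((1 / 2) * ∑ a, |π θold s a - π θ s a|)) := by
  intro i
  have hp : ∀ s a, 0 ≤ π θold s a := fun s a => (hπpos θold s a).le
  have hR : 0 ≤ Rs :=
    (abs_nonneg _).trans (hr (Classical.arbitrary S) (Classical.arbitrary A))
  have hPis : 0 ≤ Pis :=
    nonneg_of_mul_nonneg_left ((norm_nonneg _).trans
      (hscore θ (Classical.arbitrary S) (Classical.arbitrary A))) (hπpos θ _ _)
  have hB : 0 ≤ 2 * (Rs / (1 - γ)) :=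
    mul_nonneg zero_le_two (div_nonneg hR (by linarith))
  have hterm (t : ℕ) (s : S) (a : A) :
      |γ ^ t * stateMarginal p μ (π θold) t s * Adv γ r p (π θold) T t s a *
          gradient (fun θ' => π θ' s a) θ i -
        γ ^ t * stateMarginal p μ (π θold) t s *
          (if |π θ s a / π θold s a - 1| ≤ ε then (1 : ℝ) else 0) *
          Adv γ r p (π θold) T t s a * gradient (fun θ' => π θ' s a) θ i|
        ≤ stateMarginal p μ (π θold) t s * (2 * (Rs / (1 - γ)) *
          (Pis * ((1 + 1 / ε) * |π θold s a - π θ s a|))) := by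
    have hd := stateMarginal_nonneg hμ0 hp0 hp t s
    have hclip := one_sub_indicator_mul_le (x := π θ s a) hε (hπpos θold s a)
    have hadv := abs_Adv_le hγ0.le hγ1 hR hr hp0 hp1 hp (hπ1 θold) T t s a
    have hgrad : |gradient (fun θ' => π θ' s a) θ i| ≤ Pis * π θ s a :=
      (PiLp.norm_apply_le (gradient (fun θ' => π θ' s a) θ) i).trans (hscore θ s a)
    set c : ℝ := if |π θ s a / π θold s a - 1| ≤ ε then (1 : ℝ) else 0 with hc
    have hc1 : 0 ≤ 1 - c := by rw [hc]; split_ifs <;> norm_num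
    set D := stateMarginal p μ (π θold) t s
    set G := gradient (fun θ' => π θ' s a) θ i
    set U := Adv γ r p (π θold) T t s a
    calc |γ ^ t * D * U * G - γ ^ t * D * c * U * G|
        = |γ ^ t * (D * (U * ((1 - c) * G)))| := by congr 1; ring
      _ = γ ^ t * (D * (|U| * ((1 - c) * |G|))) := by
          simp only [abs_mul, abs_of_nonneg hd, abs_of_nonneg hc1,
            abs_of_nonneg (pow_nonneg hγ0.le t)]
      _ ≤ 1 * (D * (2 * (Rs / (1 - γ)) * ((1 - c) * (Pis * π θ s a)))) := by
          gcongr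
          exact pow_le_one₀ hγ0.le hγ1.le
      _ = D * (2 * (Rs / (1 - γ)) * (Pis * ((1 - c) * π θ s a))) := by ring
      _ ≤ _ := by gcongr
  have hT0 : (T : ℝ) ≠ 0 := by positivity
  calc _ ≤ ∑ t ∈ Finset.range T, ∑ s, ∑ a, stateMarginal p μ (π θold) t s *
          (2 * (Rs / (1 - γ)) * (Pis * ((1 + 1 / ε) * |π θold s a - π θ s a|))) := by
        simp only [gPPO, gPPOclip, PiLp.sub_apply, WithLp.ofLp_sum, Finset.sum_apply,
          PiLp.smul_apply, smul_eq_mul, ← Finset.sum_sub_distrib]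
        refine (Finset.abs_sum_le_sum_abs _ _).trans (Finset.sum_le_sum fun t _ => ?_)
        refine (Finset.abs_sum_le_sum_abs _ _).trans (Finset.sum_le_sum fun s _ => ?_)
        exact (Finset.abs_sum_le_sum_abs _ _).trans (Finset.sum_le_sum fun a _ => hterm t s a)
    _ = _ := by
        simp only [Finset.mul_sum]
        refine Finset.sum_congr rfl fun t _ => Finset.sum_congr rfl fun s _ =>
          Finset.sum_congr rfl fun a _ => ?_
        field_simp
        ring
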